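/- Let q = p^r be a prime power and let θ : {1,2,3,…} → 𝔽_q be a sequence that is 'irrational' in the following sense: for every nonzero b ∈ 𝔽_q[x] there exists j ≥ 1 such that ∑_i coeff(b,i)·θ(i+j) ≠ 0. Define the linear form l : 𝔽_q[x] → 𝔽_q by l(g) = ∑_{j ≥ 0} coeff(g,j)·θ(j+1), and let ψ : 𝔽_q → ℂ be the standard additive character ψ(t) = exp(2πi·Tr_{𝔽_q/𝔽_p}(t)/p). Then for every 1-bounded multiplicative function f : 𝔽_q[x] → ℂ, (1/q^n)·∑_{g ∈ G_n} f(g)·ψ(l(g)) → 0 as n → ∞. -/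

import Mathlib

open Polynomial Filter

/-- The polynomial with coefficient vector `c`, an element of `G_n` (degree < n). -/
noncomputable def polyOf {F : Type*} [Semiring F] {n : ℕ} (c : Fin n → F) : Polynomial F :=
  ∑ i, Polynomial.C (c i) * Polynomial.X ^ (i : ℕ)

/-- Multiplicative function. -/
def IsMultFn {F : Type*} [CommSemiring F] (f : Polynomial F → ℂ) : Prop :=
  ∀ g h : Polynomial F, IsCoprime g h → f (g * h) = f g * f h

/-- The linear form `l(g) = ∑_j coeff(g,j) · θ(j+1)`, i.e. the coefficient of `x^{-1}` in
`β·g` where `β = ∑_{i ≥ 1} θ(i) x^{-i}`. -/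
noncomputable def linForm {F : Type*} [Semiring F] (θ : ℕ → F) (g : Polynomial F) : F :=
  ∑ j ∈ Finset.range (g.natDegree + 1), g.coeff j * θ (j + 1)

/-- The standard additive character `ψ(t) = exp(2πi · Tr(t) / p)` of `𝔽_{p^r}`. -/
noncomputable def stdChar (p r : ℕ) [Fact p.Prime] (t : GaloisField p r) : ℂ :=
  Complex.exp (2 * Real.pi * Complex.I *
    ((Algebra.trace (ZMod p) (GaloisField p r) t).val : ℂ) / (p : ℂ))

section PolynomialBox

variable {F : Type*} [Field F]

lemma coeff_polyOf {n : ℕ} (c : Fin n → F) (i : Fin n) : (polyOf c).coeff i = c i := by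
  simp [polyOf, coeff_C_mul, coeff_X_pow, Fin.val_inj]

lemma coeff_polyOf_of_le {n : ℕ} (c : Fin n → F) {m : ℕ} (hm : n ≤ m) :
    (polyOf c).coeff m = 0 := by
  simp only [polyOf, finsetSum_coeff, coeff_C_mul, coeff_X_pow]
  refine Finset.sum_eq_zero fun i _ => ?_
  rw [if_neg (by have := i.2; lia), mul_zero]

lemma polyOf_injective {n : ℕ} : Function.Injective (polyOf : (Fin n → F) → F[X]) := by
  intro c d h
  ext i
  rw [← coeff_polyOf c, h, coeff_polyOf]

variable [Fintype F]

/-- The finite set of polynomials of degree less than `n`. -/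
noncomputable def polyBox (F : Type*) [Field F] [Fintype F] (n : ℕ) : Finset F[X] :=
  Finset.univ.map ⟨(polyOf : (Fin n → F) → F[X]), polyOf_injective⟩

lemma mem_polyBox {n : ℕ} {g : F[X]} : g ∈ polyBox F n ↔ g.degree < n := by
  rw [degree_lt_iff_coeff_zero]
  simp only [polyBox, Finset.mem_map, Finset.mem_univ, true_and, Function.Embedding.coeFn_mk]
  constructor
  · rintro ⟨c, rfl⟩ m hm
    exact coeff_polyOf_of_le c hm
  · intro h
    refine ⟨fun i => g.coeff i, ?_⟩
    ext m
    by_cases hm : m < n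
    · exact coeff_polyOf (fun i : Fin n => g.coeff i) ⟨m, hm⟩
    · rw [coeff_polyOf_of_le _ (not_lt.1 hm), h m (not_lt.1 hm)]

lemma card_polyBox (n : ℕ) : (polyBox F n).card = Fintype.card F ^ n := by
  simp [polyBox]

lemma sum_polyBox {M : Type*} [AddCommMonoid M] (n : ℕ) (φ : F[X] → M) :
    ∑ g ∈ polyBox F n, φ g = ∑ c : Fin n → F, φ (polyOf c) := by
  simp [polyBox]

lemma zero_mem_polyBox (n : ℕ) : (0 : F[X]) ∈ polyBox F n := by
  simp [mem_polyBox]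

lemma polyBox_subset {m n : ℕ} (h : m ≤ n) : polyBox F m ⊆ polyBox F n := by
  intro g hg
  rw [mem_polyBox] at *
  exact hg.trans_le (by exact_mod_cast h)

lemma mem_polyBox_iff_of_ne_zero {n : ℕ} {g : F[X]} (hg : g ≠ 0) :
    g ∈ polyBox F n ↔ g.natDegree < n := by
  rw [mem_polyBox, natDegree_lt_iff_degree_lt hg]

lemma mul_mem_polyBox {n : ℕ} {P h : F[X]} (hP : P ≠ 0) :
    P * h ∈ polyBox F n ↔ h ∈ polyBox F (n - P.natDegree) := by
  rcases eq_or_ne h 0 with rfl | hh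
  · simp [zero_mem_polyBox]
  · rw [mem_polyBox_iff_of_ne_zero (mul_ne_zero hP hh), mem_polyBox_iff_of_ne_zero hh,
      natDegree_mul hP hh]
    lia

open Classical in
lemma filter_dvd_polyBox (n : ℕ) {P : F[X]} (hP : P ≠ 0) :
    (polyBox F n).filter (P ∣ ·) =
      (polyBox F (n - P.natDegree)).map ⟨(P * ·), mul_right_injective₀ hP⟩ := by
  ext g
  simp only [Finset.mem_filter, Finset.mem_map, Function.Embedding.coeFn_mk]
  constructor
  · rintro ⟨hg, h, rfl⟩
    exact ⟨h, (mul_mem_polyBox hP).1 hg, rfl⟩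
  · rintro ⟨h, hh, rfl⟩
    exact ⟨(mul_mem_polyBox hP).2 hh, dvd_mul_right _ _⟩

open Classical in
lemma sum_filter_dvd_polyBox {M : Type*} [AddCommMonoid M] (n : ℕ) {P : F[X]} (hP : P ≠ 0)
    (φ : F[X] → M) :
    ∑ g ∈ (polyBox F n).filter (P ∣ ·), φ g = ∑ h ∈ polyBox F (n - P.natDegree), φ (P * h) := by
  rw [filter_dvd_polyBox n hP]
  simp

/-- The reciprocal norm `q ^ (-deg P)`. -/
noncomputable def invNorm (P : F[X]) : ℝ := ((Fintype.card F : ℝ) ^ P.natDegree)⁻¹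

lemma one_lt_card_cast : (1 : ℝ) < Fintype.card F := by
  exact_mod_cast Fintype.one_lt_card

lemma card_cast_pow_pos (n : ℕ) : (0 : ℝ) < (Fintype.card F : ℝ) ^ n :=
  pow_pos (zero_lt_one.trans one_lt_card_cast) n

lemma invNorm_pos (P : F[X]) : 0 < invNorm P := inv_pos.2 (card_cast_pow_pos _)

lemma invNorm_mul {P Q : F[X]} (hP : P ≠ 0) (hQ : Q ≠ 0) :
    invNorm (P * Q) = invNorm P * invNorm Q := by
  rw [invNorm, natDegree_mul hP hQ, pow_add, mul_inv]
  rfl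

lemma invNorm_le {P : F[X]} {K : ℕ} (h : K ≤ P.natDegree) :
    invNorm P ≤ ((Fintype.card F : ℝ) ^ K)⁻¹ :=
  inv_anti₀ (card_cast_pow_pos K) (pow_le_pow_right₀ one_lt_card_cast.le h)

lemma card_pow_sub {n : ℕ} {P : F[X]} (h : P.natDegree ≤ n) :
    (Fintype.card F : ℝ) ^ (n - P.natDegree) = (Fintype.card F : ℝ) ^ n * invNorm P := by
  rw [invNorm, pow_sub₀ _ (zero_lt_one.trans one_lt_card_cast).ne' h]

open Classical in
lemma card_filter_dvd_polyBox {n : ℕ} {P : F[X]} (hP : P ≠ 0) (h : P.natDegree ≤ n) :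
    (((polyBox F n).filter (P ∣ ·)).card : ℝ) = (Fintype.card F : ℝ) ^ n * invNorm P := by
  rw [filter_dvd_polyBox n hP, Finset.card_map, card_polyBox, ← card_pow_sub h]
  push_cast
  rfl

end PolynomialBox

section PrimeSum

variable {F : Type*} [Field F] [Fintype F]

open Classical in
lemma count_normalizedFactors_le {n : ℕ} {g P : F[X]} (hg : g ≠ 0) (hgn : g ∈ polyBox F n)
    (hP : Irreducible P) : (UniqueFactorizationMonoid.normalizedFactors g).count P ≤ n := by
  set m := (UniqueFactorizationMonoid.normalizedFactors g).count P with hm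
  have hdvd : P ^ m ∣ g := by
    have h := Multiset.prod_dvd_prod_of_le (Multiset.le_count_iff_replicate_le.1 hm.le)
    rw [Multiset.prod_replicate] at h
    refine h.trans ?_
    conv_rhs => rw [← leadingCoeff_mul_prod_normalizedFactors g]
    exact dvd_mul_left _ _
  have h1 := natDegree_le_of_dvd hdvd hg
  rw [natDegree_pow] at h1
  have h2 := (mem_polyBox_iff_of_ne_zero hg).1 hgn
  have h3 := hP.natDegree_pos
  nlinarith

open Classical in
/-- There are few polynomials of degree less than `n` with all prime factors of degree
at most `K`. -/
lemma card_smooth_le (K n : ℕ) :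
    ((polyBox F n).filter fun g => g ≠ 0 ∧
      ∀ P : F[X], P.Monic → Irreducible P → P ∣ g → P.natDegree ≤ K).card ≤
      Fintype.card F * (n + 1) ^ (polyBox F (K + 1)).card := by
  let code : F[X] → F × (polyBox F (K + 1) → Fin (n + 1)) := fun g =>
    (g.leadingCoeff, fun P =>
      Fin.ofNat (n + 1) ((UniqueFactorizationMonoid.normalizedFactors g).count P.1))
  have hinj : Set.InjOn code ((polyBox F n).filter fun g => g ≠ 0 ∧
      ∀ P : F[X], P.Monic → Irreducible P → P ∣ g → P.natDegree ≤ K) := by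
    intro g hg g' hg' h
    simp only [Finset.coe_filter, Set.mem_ofPred_eq] at hg hg'
    obtain ⟨hgn, hg0, hgK⟩ := hg
    obtain ⟨hgn', hg0', hgK'⟩ := hg'
    simp only [code, Prod.mk.injEq] at h
    obtain ⟨hlc, hcount⟩ := h
    rw [← leadingCoeff_mul_prod_normalizedFactors g,
      ← leadingCoeff_mul_prod_normalizedFactors g', hlc]
    congr 2
    ext P
    by_cases hP : P.Monic ∧ Irreducible P
    · by_cases hdeg : P.natDegree ≤ K
      · have hmem : P ∈ polyBox F (K + 1) :=
          (mem_polyBox_iff_of_ne_zero hP.1.ne_zero).2 (by lia)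
        have h := congrArg Fin.val (congrFun hcount ⟨P, hmem⟩)
        simp only [Fin.ofNat] at h
        rwa [Nat.mod_eq_of_lt (Nat.lt_succ_of_le (count_normalizedFactors_le hg0 hgn hP.2)),
          Nat.mod_eq_of_lt (Nat.lt_succ_of_le (count_normalizedFactors_le hg0' hgn' hP.2))] at h
      · rw [Multiset.count_eq_zero_of_notMem, Multiset.count_eq_zero_of_notMem]
        · exact fun h => hdeg (hgK' P hP.1 hP.2
            (UniqueFactorizationMonoid.dvd_of_mem_normalizedFactors h))
        · exact fun h => hdeg (hgK P hP.1 hP.2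
            (UniqueFactorizationMonoid.dvd_of_mem_normalizedFactors h))
    · rw [Multiset.count_eq_zero_of_notMem, Multiset.count_eq_zero_of_notMem]
      · exact fun h => hP ⟨((Polynomial.mem_normalizedFactors_iff hg0').1 h).2.1,
          ((Polynomial.mem_normalizedFactors_iff hg0').1 h).1⟩
      · exact fun h => hP ⟨((Polynomial.mem_normalizedFactors_iff hg0).1 h).2.1,
          ((Polynomial.mem_normalizedFactors_iff hg0).1 h).1⟩
  have h := Finset.card_le_card_of_injOn (t := Finset.univ) code (fun _ _ => Finset.mem_univ _) hinj
  simpa [Fintype.card_prod, Fintype.card_fun] using h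

lemma exists_poly_le_half_pow (a : ℝ) (k : ℕ) {q : ℝ} (hq : 1 < q) :
    ∃ n : ℕ, 1 + a * ((n : ℝ) + 1) ^ k ≤ q ^ n / 2 := by
  have h1 := (tendsto_pow_const_div_const_pow_of_one_lt k hq).comp (tendsto_add_atTop_nat 1)
  have h2 := tendsto_pow_const_div_const_pow_of_one_lt 0 hq
  have h3 := h2.add (h1.const_mul (a * q))
  rw [mul_zero, add_zero] at h3
  obtain ⟨n, hn⟩ := (h3.eventually (ge_mem_nhds (by norm_num : (0 : ℝ) < 1 / 2))).exists
  refine ⟨n, ?_⟩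
  have hq0 : 0 < q := zero_lt_one.trans hq
  have hpos : 0 < q ^ n := pow_pos hq0 n
  have heq : 1 + a * ((n : ℝ) + 1) ^ k =
      q ^ n * ((n : ℝ) ^ 0 / q ^ n + a * q * (((n + 1 : ℕ) : ℝ) ^ k / q ^ (n + 1))) := by
    rw [pow_succ q n]
    push_cast
    field_simp
  rw [heq]
  calc _ ≤ q ^ n * (1 / 2) := mul_le_mul_of_nonneg_left hn hpos.le
    _ = _ := by ring

open Classical in
/-- The primes of degree greater than `K` carry a reciprocal mass of at least one half. -/
lemma exists_primes_half_le_sum_invNorm (K : ℕ) :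
    ∃ T : Finset F[X], (∀ P ∈ T, P.Monic ∧ Irreducible P ∧ K < P.natDegree) ∧
      1 / 2 ≤ ∑ P ∈ T, invNorm P := by
  obtain ⟨n, hn⟩ := exists_poly_le_half_pow (Fintype.card F : ℝ) (polyBox F (K + 1)).card
    (one_lt_card_cast (F := F))
  let T := (polyBox F n).filter fun P => P.Monic ∧ Irreducible P ∧ K < P.natDegree
  refine ⟨T, fun P hP => (Finset.mem_filter.1 hP).2, ?_⟩
  let smooth := (polyBox F n).filter fun g => g ≠ 0 ∧
      ∀ P : F[X], P.Monic → Irreducible P → P ∣ g → P.natDegree ≤ K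
  have hcover : polyBox F n ⊆
      ({0} ∪ smooth) ∪ T.biUnion fun P => (polyBox F n).filter (P ∣ ·) := by
    intro g hg
    rcases eq_or_ne g 0 with rfl | hg0
    · simp
    by_cases hs : ∀ P : F[X], P.Monic → Irreducible P → P ∣ g → P.natDegree ≤ K
    · exact Finset.mem_union_left _ (Finset.mem_union_right _
        (Finset.mem_filter.2 ⟨hg, hg0, hs⟩))
    · push Not at hs
      obtain ⟨P, hPm, hPi, hPg, hPK⟩ := hs
      refine Finset.mem_union_right _ (Finset.mem_biUnion.2 ⟨P, ?_, by simp [hg, hPg]⟩)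
      refine Finset.mem_filter.2 ⟨?_, hPm, hPi, hPK⟩
      rw [mem_polyBox_iff_of_ne_zero hPm.ne_zero]
      exact (natDegree_le_of_dvd hPg hg0).trans_lt ((mem_polyBox_iff_of_ne_zero hg0).1 hg)
  have hcard : Fintype.card F ^ n ≤ 1 + Fintype.card F * (n + 1) ^ (polyBox F (K + 1)).card +
      ∑ P ∈ T, ((polyBox F n).filter (P ∣ ·)).card := by
    rw [← card_polyBox n]
    refine (Finset.card_le_card hcover).trans ((Finset.card_union_le _ _).trans
      (add_le_add ((Finset.card_union_le _ _).trans ?_) Finset.card_biUnion_le))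
    exact add_le_add (by simp) (card_smooth_le K n)
  have hsum : ((∑ P ∈ T, ((polyBox F n).filter (P ∣ ·)).card : ℕ) : ℝ) =
      (Fintype.card F : ℝ) ^ n * ∑ P ∈ T, invNorm P := by
    push_cast
    rw [Finset.mul_sum]
    refine Finset.sum_congr rfl fun P hP => ?_
    obtain ⟨hPn, hPm, -, -⟩ := Finset.mem_filter.1 hP
    exact card_filter_dvd_polyBox hPm.ne_zero ((mem_polyBox_iff_of_ne_zero hPm.ne_zero).1 hPn).le
  have hcardR : (Fintype.card F : ℝ) ^ n ≤
      1 + (Fintype.card F : ℝ) * ((n : ℝ) + 1) ^ (polyBox F (K + 1)).card +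
        (Fintype.card F : ℝ) ^ n * ∑ P ∈ T, invNorm P := by
    rw [← hsum]
    exact_mod_cast hcard
  have hpos := card_cast_pow_pos (F := F) n
  refine le_of_mul_le_mul_left ?_ hpos
  linarith

open Classical in
/-- The sum of the reciprocal norms of the primes of degree greater than `K` diverges. -/
lemma exists_primes_le_sum_invNorm (K m : ℕ) :
    ∃ T : Finset F[X], (∀ P ∈ T, P.Monic ∧ Irreducible P ∧ K < P.natDegree) ∧
      (m : ℝ) / 2 ≤ ∑ P ∈ T, invNorm P := by
  induction m with
  | zero => exact ⟨∅, by simp, by simp⟩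
  | succ m ih =>
    obtain ⟨T, hT, hTs⟩ := ih
    obtain ⟨U, hU, hUs⟩ :=
      exists_primes_half_le_sum_invNorm (F := F) (K + ∑ P ∈ T, P.natDegree)
    refine ⟨T ∪ U, fun P hP => ?_, ?_⟩
    · rcases Finset.mem_union.1 hP with h | h
      · exact hT P h
      · exact ⟨(hU P h).1, (hU P h).2.1, by have := (hU P h).2.2; lia⟩
    · rw [Finset.sum_union]
      · push_cast
        linarith
      · refine Finset.disjoint_left.2 fun P hPT hPU => ?_
        have h1 := (hU P hPU).2.2
        have h2 := Finset.single_le_sum (f := natDegree) (fun _ _ => Nat.zero_le _) hPT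
        lia

end PrimeSum

section Katai

open scoped ComplexConjugate

lemma sum_norm_sq_sum_of_orthogonal {𝕜 ι κ : Type*} [RCLike 𝕜] (T : Finset ι) (S : Finset κ)
    (x : ι → κ → 𝕜)
    (horth : ∀ P ∈ T, ∀ Q ∈ T, P ≠ Q → ∑ h ∈ S, x P h * conj (x Q h) = 0) :
    ∑ h ∈ S, ‖∑ P ∈ T, x P h‖ ^ 2 = ∑ P ∈ T, ∑ h ∈ S, ‖x P h‖ ^ 2 := by
  refine RCLike.ofReal_injective (K := 𝕜) ?_
  push_cast
  simp_rw [← RCLike.mul_conj, map_sum, Finset.sum_mul_sum]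
  rw [Finset.sum_comm]
  refine Finset.sum_congr rfl fun P hP => ?_
  rw [Finset.sum_comm, Finset.sum_eq_single_of_mem P hP]
  exact fun Q hQ hne => horth P hP Q hQ hne.symm

lemma norm_sum_mul_le {R κ : Type*} [SeminormedRing R] (S : Finset κ) (a b : κ → R) {N B : ℝ}
    (ha : ∀ h ∈ S, ‖a h‖ ≤ 1) (hN : (S.card : ℝ) ≤ N) (hB : 0 ≤ B)
    (hb : ∑ h ∈ S, ‖b h‖ ^ 2 ≤ N * B) :
    ‖∑ h ∈ S, a h * b h‖ ≤ N * √B := by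
  have hN0 : 0 ≤ N := (Nat.cast_nonneg _).trans hN
  have h1 : ‖∑ h ∈ S, a h * b h‖ ≤ ∑ h ∈ S, ‖b h‖ :=
    norm_sum_le_of_le _ fun h hh => (norm_mul_le _ _).trans
      (mul_le_of_le_one_left (norm_nonneg _) (ha h hh))
  refine h1.trans (abs_le_of_sq_le_sq' ?_ (by positivity)).2
  calc (∑ h ∈ S, ‖b h‖) ^ 2 ≤ S.card * ∑ h ∈ S, ‖b h‖ ^ 2 := sq_sum_le_card_mul_sum_sq
    _ ≤ N * (N * B) := by gcongr
    _ = (N * √B) ^ 2 := by rw [mul_pow, Real.sq_sqrt hB]; ring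

lemma isCoprime_of_monic_irreducible {F : Type*} [Field F] {P Q : F[X]} (hP : P.Monic) (hPi : Irreducible P)
    (hQ : Q.Monic) (hQi : Irreducible Q) (hne : P ≠ Q) : IsCoprime P Q :=
  hPi.isCoprime_or_dvd Q |>.resolve_right fun h =>
    hne (eq_of_monic_of_associated hP hQ (hPi.associated_of_dvd hQi h))

variable {F : Type*} [Field F] [Fintype F]

open Classical in
lemma sum_ite_dvd_polyBox {n : ℕ} {P : F[X]} (hP : P ≠ 0) (h : P.natDegree ≤ n) :
    ∑ g ∈ polyBox F n, (if P ∣ g then (1 : ℝ) else 0) = (Fintype.card F : ℝ) ^ n * invNorm P := by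
  rw [← card_filter_dvd_polyBox hP h, Finset.sum_boole]

open Classical in
/-- Turán–Kubilius inequality for polynomials over a finite field. -/
lemma turan_kubilius {n : ℕ} (T : Finset F[X]) (hT : ∀ P ∈ T, P.Monic ∧ Irreducible P)
    (hn : ∀ P ∈ T, ∀ Q ∈ T, P.natDegree + Q.natDegree ≤ n) :
    ∑ g ∈ polyBox F n, ‖∑ P ∈ T, ((if P ∣ g then (1 : ℝ) else 0) - invNorm P)‖ ^ 2 ≤
      (Fintype.card F : ℝ) ^ n * ∑ P ∈ T, invNorm P := by
  have hP0 : ∀ P ∈ T, P ≠ 0 := fun P hP => (hT P hP).1.ne_zero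
  have hPn : ∀ P ∈ T, P.natDegree ≤ n := fun P hP => by have := hn P hP P hP; lia
  have hconst : ∀ c : ℝ, ∑ g ∈ polyBox F n, c = (Fintype.card F : ℝ) ^ n * c := fun c => by
    rw [Finset.sum_const, card_polyBox, nsmul_eq_mul]
    push_cast
    rfl
  rw [sum_norm_sq_sum_of_orthogonal, Finset.mul_sum]
  · refine Finset.sum_le_sum fun P hP => ?_
    have hexp : ∀ g, ‖(if P ∣ g then (1 : ℝ) else 0) - invNorm P‖ ^ 2 =
        (1 - 2 * invNorm P) * (if P ∣ g then (1 : ℝ) else 0) + invNorm P ^ 2 := by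
      intro g
      rw [Real.norm_eq_abs, sq_abs]
      split_ifs <;> ring
    simp_rw [hexp]
    rw [Finset.sum_add_distrib, ← Finset.mul_sum, sum_ite_dvd_polyBox (hP0 P hP) (hPn P hP),
      hconst]
    have := mul_nonneg (card_cast_pow_pos (F := F) n).le (sq_nonneg (invNorm P))
    nlinarith
  · intro P hP Q hQ hne
    have hcop := isCoprime_of_monic_irreducible (hT P hP).1 (hT P hP).2 (hT Q hQ).1 (hT Q hQ).2 hne
    have hexp : ∀ g, ((if P ∣ g then (1 : ℝ) else 0) - invNorm P) *
        conj ((if Q ∣ g then (1 : ℝ) else 0) - invNorm Q) =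
        (if P * Q ∣ g then (1 : ℝ) else 0) - invNorm Q * (if P ∣ g then (1 : ℝ) else 0) -
          invNorm P * (if Q ∣ g then (1 : ℝ) else 0) + invNorm P * invNorm Q := by
      intro g
      have hdvd : P * Q ∣ g ↔ P ∣ g ∧ Q ∣ g :=
        ⟨fun h => ⟨(dvd_mul_right _ _).trans h, (dvd_mul_left _ _).trans h⟩,
          fun h => hcop.mul_dvd h.1 h.2⟩
      simp only [hdvd, conj_trivial]
      by_cases h1 : P ∣ g <;> by_cases h2 : Q ∣ g <;> simp [h1, h2] <;> ring
    simp_rw [hexp]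
    rw [Finset.sum_add_distrib, Finset.sum_sub_distrib, Finset.sum_sub_distrib, ← Finset.mul_sum,
      ← Finset.mul_sum, sum_ite_dvd_polyBox (hP0 P hP) (hPn P hP),
      sum_ite_dvd_polyBox (hP0 Q hQ) (hPn Q hQ),
      sum_ite_dvd_polyBox (mul_ne_zero (hP0 P hP) (hP0 Q hQ))
        ((natDegree_mul_le).trans (hn P hP Q hQ)),
      invNorm_mul (hP0 P hP) (hP0 Q hQ), hconst]
    ring

variable {f e : F[X] → ℂ}

open Classical in
/-- The bilinear sum over primes in `T` is small when the off-diagonal correlations vanish. -/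
lemma norm_bilinear_sum_le {n : ℕ} (T : Finset F[X]) (hfb : ∀ g, ‖f g‖ ≤ 1)
    (heb : ∀ g, ‖e g‖ ≤ 1) (hsub : ∀ a b, e (a - b) = e a * conj (e b))
    (hn : ∀ P ∈ T, P.natDegree ≤ n)
    (hvan : ∀ P ∈ T, ∀ Q ∈ T, P ≠ Q →
      ∑ h ∈ polyBox F (n - max P.natDegree Q.natDegree), e ((P - Q) * h) = 0) :
    ‖∑ P ∈ T, ∑ h ∈ polyBox F (n - P.natDegree), f P * f h * e (P * h)‖ ≤
      (Fintype.card F : ℝ) ^ n * √(∑ P ∈ T, invNorm P) := by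
  let x : F[X] → F[X] → ℂ := fun P h =>
    if h ∈ polyBox F (n - P.natDegree) then f P * e (P * h) else 0
  have hbox : ∀ m, (polyBox F n).filter (· ∈ polyBox F (n - m)) = polyBox F (n - m) := fun m => by
    rw [Finset.filter_mem_eq_inter, Finset.inter_eq_right]
    exact polyBox_subset (Nat.sub_le _ _)
  have hrew : ∑ P ∈ T, ∑ h ∈ polyBox F (n - P.natDegree), f P * f h * e (P * h) =
      ∑ h ∈ polyBox F n, f h * ∑ P ∈ T, x P h := by
    simp_rw [Finset.mul_sum]
    rw [Finset.sum_comm]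
    refine Finset.sum_congr rfl fun P _ => ?_
    simp only [x, mul_ite, mul_zero]
    rw [← Finset.sum_filter, hbox]
    exact Finset.sum_congr rfl fun h _ => by ring
  rw [hrew]
  refine norm_sum_mul_le _ _ _ (fun h _ => hfb h) (by rw [card_polyBox]; push_cast; rfl)
    (Finset.sum_nonneg fun P _ => (invNorm_pos P).le) ?_
  rw [sum_norm_sq_sum_of_orthogonal, Finset.mul_sum]
  · refine Finset.sum_le_sum fun P hP => ?_
    have hx : ∀ h, ‖x P h‖ ^ 2 ≤ if h ∈ polyBox F (n - P.natDegree) then 1 else 0 := by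
      intro h
      simp only [x]
      split_ifs
      · rw [norm_mul]
        exact pow_le_one₀ (by positivity) (mul_le_one₀ (hfb _) (norm_nonneg _) (heb _))
      · simp
    refine (Finset.sum_le_sum fun h _ => hx h).trans ?_
    rw [Finset.sum_boole, hbox, card_polyBox, ← card_pow_sub (hn P hP)]
    push_cast
    rfl
  · intro P hP Q hQ hne
    have hx : ∀ h, x P h * conj (x Q h) =
        if h ∈ polyBox F (n - max P.natDegree Q.natDegree) then
          f P * conj (f Q) * e ((P - Q) * h) else 0 := by
      intro h
      have hiff : h ∈ polyBox F (n - max P.natDegree Q.natDegree) ↔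
          h ∈ polyBox F (n - P.natDegree) ∧ h ∈ polyBox F (n - Q.natDegree) := by
        rcases eq_or_ne h 0 with rfl | hh
        · simp [zero_mem_polyBox]
        · simp only [mem_polyBox_iff_of_ne_zero hh]
          lia
      simp only [x, hiff, sub_mul, hsub]
      split_ifs <;> simp_all
      ring
    simp_rw [hx]
    rw [← Finset.sum_filter, hbox, ← Finset.mul_sum, hvan P hP Q hQ hne, mul_zero]

open Classical in
/-- Replacing `f (P * h)` by `f P * f h` costs only the multiples of `P`. -/
lemma norm_sum_sub_le_of_isMultFn {n : ℕ} {P : F[X]} (hf : IsMultFn f) (hfb : ∀ g, ‖f g‖ ≤ 1)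
    (heb : ∀ g, ‖e g‖ ≤ 1) (hP0 : P ≠ 0) (hP : Irreducible P)
    (hn : P.natDegree + P.natDegree ≤ n) :
    ‖∑ h ∈ polyBox F (n - P.natDegree), (f (P * h) * e (P * h) - f P * f h * e (P * h))‖ ≤
      (Fintype.card F : ℝ) ^ n * (2 * invNorm P ^ 2) := by
  have hterm : ∀ h, ‖f (P * h) * e (P * h) - f P * f h * e (P * h)‖ ≤
      2 * (if P ∣ h then (1 : ℝ) else 0) := by
    intro h
    split_ifs with hd
    · have h1 : ‖f (P * h) * e (P * h)‖ ≤ 1 := by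
        rw [norm_mul]
        exact mul_le_one₀ (hfb _) (norm_nonneg _) (heb _)
      have h2 : ‖f P * f h * e (P * h)‖ ≤ 1 := by
        rw [norm_mul, norm_mul]
        exact mul_le_one₀ (mul_le_one₀ (hfb _) (norm_nonneg _) (hfb _)) (norm_nonneg _) (heb _)
      linarith [norm_sub_le (f (P * h) * e (P * h)) (f P * f h * e (P * h))]
    · rw [hf P h ((hP.isCoprime_or_dvd h).resolve_right hd)]
      simp
  refine (norm_sum_le_of_le _ fun h _ => hterm h).trans ?_
  rw [← Finset.mul_sum, sum_ite_dvd_polyBox hP0 (by lia), card_pow_sub (by lia)]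
  exact le_of_eq (by ring)

open Classical in
/-- Quantitative Kátai inequality relative to a finite set `T` of primes. -/
lemma katai_inequality {n : ℕ} (T : Finset F[X]) (hT : ∀ P ∈ T, P.Monic ∧ Irreducible P)
    (hf : IsMultFn f) (hfb : ∀ g, ‖f g‖ ≤ 1)
    (heb : ∀ g, ‖e g‖ ≤ 1) (hsub : ∀ a b, e (a - b) = e a * conj (e b))
    (hn : ∀ P ∈ T, ∀ Q ∈ T, P.natDegree + Q.natDegree ≤ n)
    (hvan : ∀ P ∈ T, ∀ Q ∈ T, P ≠ Q →
      ∑ h ∈ polyBox F (n - max P.natDegree Q.natDegree), e ((P - Q) * h) = 0) :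
    (∑ P ∈ T, invNorm P) * ‖∑ g ∈ polyBox F n, f g * e g‖ ≤
      (Fintype.card F : ℝ) ^ n *
        (2 * √(∑ P ∈ T, invNorm P) + 2 * ∑ P ∈ T, invNorm P ^ 2) := by
  set A := ∑ P ∈ T, invNorm P with hA
  have hA0 : 0 ≤ A := Finset.sum_nonneg fun P _ => (invNorm_pos P).le
  let main := ∑ P ∈ T, ∑ h ∈ polyBox F (n - P.natDegree), f P * f h * e (P * h)
  let err := ∑ P ∈ T, ∑ h ∈ polyBox F (n - P.natDegree),
    (f (P * h) * e (P * h) - f P * f h * e (P * h))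
  let fluct := ∑ g ∈ polyBox F n, (f g * e g) *
    ((∑ P ∈ T, ((if P ∣ g then (1 : ℝ) else 0) - invNorm P) : ℝ) : ℂ)
  have hdecomp : (A : ℂ) * ∑ g ∈ polyBox F n, f g * e g = main + err - fluct := by
    have h1 : main + err = ∑ g ∈ polyBox F n, (f g * e g) *
        ((∑ P ∈ T, (if P ∣ g then (1 : ℝ) else 0) : ℝ) : ℂ) := by
      simp only [main, err]
      rw [← Finset.sum_add_distrib]
      push_cast
      simp_rw [Finset.mul_sum]
      rw [Finset.sum_comm]
      refine Finset.sum_congr rfl fun P hP => ?_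
      rw [← Finset.sum_add_distrib]
      simp only [add_sub_cancel]
      rw [← sum_filter_dvd_polyBox n (hT P hP).1.ne_zero (fun g => f g * e g), Finset.sum_filter]
      refine Finset.sum_congr rfl fun g _ => ?_
      split_ifs <;> simp
    rw [h1]
    simp only [fluct]
    rw [← Finset.sum_sub_distrib, Finset.mul_sum]
    refine Finset.sum_congr rfl fun g _ => ?_
    rw [Finset.sum_sub_distrib, ← hA]
    push_cast
    ring
  have hmain : ‖main‖ ≤ (Fintype.card F : ℝ) ^ n * √A :=
    norm_bilinear_sum_le T hfb heb hsub (fun P hP => by have := hn P hP P hP; lia) hvan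
  have herr : ‖err‖ ≤ (Fintype.card F : ℝ) ^ n * (2 * ∑ P ∈ T, invNorm P ^ 2) := by
    rw [Finset.mul_sum, Finset.mul_sum]
    exact norm_sum_le_of_le _ fun P hP => norm_sum_sub_le_of_isMultFn hf hfb heb
      (hT P hP).1.ne_zero (hT P hP).2 (hn P hP P hP)
  have hfluct : ‖fluct‖ ≤ (Fintype.card F : ℝ) ^ n * √A := by
    refine norm_sum_mul_le _ _ _ (fun g _ => ?_) (by rw [card_polyBox]; push_cast; rfl) hA0 ?_
    · rw [norm_mul]
      exact mul_le_one₀ (hfb _) (norm_nonneg _) (heb _)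
    · simp_rw [Complex.norm_real]
      exact turan_kubilius T hT hn
  calc A * ‖∑ g ∈ polyBox F n, f g * e g‖ = ‖(A : ℂ) * ∑ g ∈ polyBox F n, f g * e g‖ := by
        rw [norm_mul, Complex.norm_real, Real.norm_of_nonneg hA0]
    _ = ‖main + err - fluct‖ := by rw [hdecomp]
    _ ≤ ‖main‖ + ‖err‖ + ‖fluct‖ := (norm_sub_le _ _).trans (by gcongr; exact norm_add_le _ _)
    _ ≤ _ := by linarith

/-- A multiplicative function is asymptotically orthogonal to any unitary character `e` of `F[X]`
whose dilates by nonzero polynomials eventually have vanishing sums. -/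
theorem tendsto_mean_mul_character (hf : IsMultFn f) (hfb : ∀ g, ‖f g‖ ≤ 1)
    (heb : ∀ g, ‖e g‖ ≤ 1) (hsub : ∀ a b, e (a - b) = e a * conj (e b))
    (hvan : ∀ b : F[X], b ≠ 0 → ∀ᶠ n in atTop, ∑ h ∈ polyBox F n, e (b * h) = 0) :
    Tendsto (fun n : ℕ => (1 / (Fintype.card F : ℂ) ^ n) * ∑ g ∈ polyBox F n, f g * e g)
      atTop (nhds 0) := by
  rw [Metric.tendsto_nhds]
  intro ε hε
  obtain ⟨K, hK⟩ := exists_pow_lt_of_lt_one (show (0 : ℝ) < ε / 4 by positivity)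
    (inv_lt_one_of_one_lt₀ (one_lt_card_cast (F := F)))
  obtain ⟨m, hm⟩ := exists_nat_gt (2 * (4 / ε) ^ 2)
  obtain ⟨T, hT, hTm⟩ := exists_primes_le_sum_invNorm (F := F) K m
  set A := ∑ P ∈ T, invNorm P with hA
  have hA4 : (4 / ε) ^ 2 < A := by linarith
  have hApos : 0 < A := (by positivity : 0 < (4 / ε) ^ 2).trans hA4
  have hsqrt : 4 / ε < √A := Real.lt_sqrt_of_sq_lt hA4
  have hsq : ∑ P ∈ T, invNorm P ^ 2 ≤ ε / 4 * A := by
    rw [hA, Finset.mul_sum]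
    refine Finset.sum_le_sum fun P hP => ?_
    rw [sq]
    refine mul_le_mul_of_nonneg_right ?_ (invNorm_pos P).le
    refine (invNorm_le (hT P hP).2.2.le).trans ?_
    rw [← inv_pow]
    exact hK.le
  have hdeg : ∀ᶠ n in atTop, ∀ P ∈ T, ∀ Q ∈ T, P.natDegree + Q.natDegree ≤ n := by
    simp only [eventually_all_finset]
    exact fun P _ Q _ => eventually_ge_atTop _
  have hcorr : ∀ᶠ n in atTop, ∀ P ∈ T, ∀ Q ∈ T, P ≠ Q →
      ∑ h ∈ polyBox F (n - max P.natDegree Q.natDegree), e ((P - Q) * h) = 0 := by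
    simp only [eventually_all_finset]
    intro P _ Q _
    rcases eq_or_ne P Q with rfl | hne
    · simp
    · filter_upwards [(tendsto_sub_atTop_nat _).eventually (hvan (P - Q) (sub_ne_zero.2 hne))]
        with n hn _ using hn
  filter_upwards [hdeg, hcorr] with n hn hc
  have hkey := katai_inequality T (fun P hP => ⟨(hT P hP).1, (hT P hP).2.1⟩) hf hfb heb hsub hn hc
  rw [← hA] at hkey
  have hq := card_cast_pow_pos (F := F) n
  rw [dist_zero_right, norm_mul, norm_div, norm_one, norm_pow, Complex.norm_natCast, one_div,
    inv_mul_lt_iff₀ hq]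
  refine lt_of_mul_lt_mul_left (hkey.trans_lt ?_) hApos.le
  have h1 : 2 * √A + 2 * ∑ P ∈ T, invNorm P ^ 2 < A * ε := by
    have h2 : 4 < √A * ε := (div_lt_iff₀ hε).1 hsqrt
    have h3 : 0 < √A := Real.sqrt_pos.2 hApos
    have h4 : √A * √A = A := Real.mul_self_sqrt hApos.le
    nlinarith
  calc _ < (Fintype.card F : ℝ) ^ n * (A * ε) := mul_lt_mul_of_pos_left h1 hq
    _ = _ := by ring

end Katai

section Character

open scoped ComplexConjugate

lemma linForm_eq_sum_range {F : Type*} [Semiring F] (θ : ℕ → F) (g : F[X]) {N : ℕ}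
    (hN : g.natDegree < N) :
    linForm θ g = ∑ j ∈ Finset.range N, g.coeff j * θ (j + 1) := by
  refine Finset.sum_subset (Finset.range_mono hN) fun j _ hj => ?_
  rw [coeff_eq_zero_of_natDegree_lt (by simpa using hj), zero_mul]

lemma linForm_add {F : Type*} [Semiring F] (θ : ℕ → F) (g h : F[X]) :
    linForm θ (g + h) = linForm θ g + linForm θ h := by
  have hN := natDegree_add_le g h
  rw [linForm_eq_sum_range θ (g + h) (N := max g.natDegree h.natDegree + 1) (by lia),
    linForm_eq_sum_range θ g (N := max g.natDegree h.natDegree + 1) (by lia),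
    linForm_eq_sum_range θ h (N := max g.natDegree h.natDegree + 1) (by lia),
    ← Finset.sum_add_distrib]
  simp [add_mul]

lemma linForm_C_mul {F : Type*} [Semiring F] (θ : ℕ → F) (a : F) (g : F[X]) :
    linForm θ (C a * g) = a * linForm θ g := by
  rw [linForm_eq_sum_range θ (C a * g) (Nat.lt_succ_of_le (natDegree_C_mul_le a g)), linForm,
    Finset.mul_sum]
  simp [mul_assoc]

lemma linForm_mul_X_pow {F : Type*} [Semiring F] (θ : ℕ → F) (b : F[X]) (k : ℕ) :
    linForm θ (b * X ^ k) =
      ∑ i ∈ Finset.range (b.natDegree + 1), b.coeff i * θ (i + (k + 1)) := by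
  rw [linForm_eq_sum_range θ (b * X ^ k) (N := k + (b.natDegree + 1)), Finset.sum_range_add,
    Finset.sum_eq_zero, zero_add]
  · refine Finset.sum_congr rfl fun i _ => ?_
    rw [add_comm k i, coeff_mul_X_pow, add_assoc]
  · intro i hi
    rw [coeff_mul_X_pow', if_neg (by simpa using hi), zero_mul]
  · have h1 := natDegree_mul_le (p := b) (q := X ^ k)
    have h2 := natDegree_X_pow_le (R := F) k
    lia

variable {p r : ℕ} [Fact p.Prime]

lemma stdChar_eq (t : GaloisField p r) :
    stdChar p r t = ZMod.stdAddChar (Algebra.trace (ZMod p) (GaloisField p r) t) := by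
  rw [ZMod.stdAddChar_apply, ZMod.toCircle_apply, stdChar]

lemma stdChar_add (s t : GaloisField p r) :
    stdChar p r (s + t) = stdChar p r s * stdChar p r t := by
  rw [stdChar_eq, stdChar_eq, stdChar_eq, map_add, AddChar.map_add_eq_mul]

lemma norm_stdChar (t : GaloisField p r) : ‖stdChar p r t‖ = 1 := by
  rw [stdChar_eq, ZMod.stdAddChar_apply, Circle.norm_coe]

lemma exists_stdChar_ne_one (p r : ℕ) [Fact p.Prime] :
    ∃ t : GaloisField p r, stdChar p r t ≠ 1 := by
  have hne : Algebra.trace (ZMod p) (GaloisField p r) ≠ 0 := Algebra.trace_ne_zero _ _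
  obtain ⟨t, ht⟩ := DFunLike.ne_iff.1 hne
  refine ⟨t, fun h => ht ?_⟩
  rw [stdChar_eq, ← AddChar.map_zero_eq_one (ZMod.stdAddChar (N := p))] at h
  exact ZMod.injective_stdAddChar h

lemma add_mem_polyBox {F : Type*} [Field F] [Fintype F] {n : ℕ} {g h : F[X]}
    (hg : g ∈ polyBox F n) (hh : h ∈ polyBox F n) : g + h ∈ polyBox F n := by
  rw [mem_polyBox] at *
  exact (degree_add_le g h).trans_lt (max_lt hg hh)

lemma sub_mem_polyBox {F : Type*} [Field F] [Fintype F] {n : ℕ} {g h : F[X]}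
    (hg : g ∈ polyBox F n) (hh : h ∈ polyBox F n) : g - h ∈ polyBox F n := by
  rw [mem_polyBox] at *
  exact (degree_sub_le g h).trans_lt (max_lt hg hh)

lemma eventually_sum_stdChar_linForm_eq_zero [Fintype (GaloisField p r)]
    (θ : ℕ → GaloisField p r) (b : (GaloisField p r)[X])
    (hb : ∃ j : ℕ, 1 ≤ j ∧
      ∑ i ∈ Finset.range (b.natDegree + 1), b.coeff i * θ (i + j) ≠ 0) :
    ∀ᶠ n in atTop,
      ∑ h ∈ polyBox (GaloisField p r) n, stdChar p r (linForm θ (b * h)) = 0 := by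
  obtain ⟨j, hj, hne⟩ := hb
  obtain ⟨k, rfl⟩ := Nat.exists_eq_add_of_le' hj
  rw [← linForm_mul_X_pow] at hne
  obtain ⟨t, ht⟩ := exists_stdChar_ne_one p r
  set a := t * (linForm θ (b * X ^ k))⁻¹
  have hval : linForm θ (b * (C a * X ^ k)) = t := by
    rw [mul_left_comm, linForm_C_mul, inv_mul_cancel_right₀ hne]
  filter_upwards [eventually_gt_atTop k] with n hn
  have hmem : C a * X ^ k ∈ polyBox (GaloisField p r) n := by
    rw [mem_polyBox]
    exact (degree_C_mul_X_pow_le k a).trans_lt (by exact_mod_cast hn)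
  have hshift : ∑ h ∈ polyBox (GaloisField p r) n, stdChar p r (linForm θ (b * h)) =
      stdChar p r t * ∑ h ∈ polyBox (GaloisField p r) n, stdChar p r (linForm θ (b * h)) := by
    rw [Finset.mul_sum]
    refine Finset.sum_bij' (fun h _ => h - C a * X ^ k) (fun h _ => h + C a * X ^ k)
      (fun h hh => sub_mem_polyBox hh hmem) (fun h hh => add_mem_polyBox hh hmem)
      (by simp) (by simp) fun h _ => ?_
    rw [← stdChar_add, ← hval, ← linForm_add, ← mul_add, add_sub_cancel]
  by_contra hS
  exact ht (mul_right_cancel₀ hS (by rw [one_mul]; exact hshift.symm))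

end Character

theorem stmt12 (p r : ℕ) [Fact p.Prime] (hr : 0 < r) [Fintype (GaloisField p r)]
    (θ : ℕ → GaloisField p r)
    (hirr : ∀ b : Polynomial (GaloisField p r), b ≠ 0 →
      ∃ j : ℕ, 1 ≤ j ∧ ∑ i ∈ Finset.range (b.natDegree + 1), b.coeff i * θ (i + j) ≠ 0)
    (f : Polynomial (GaloisField p r) → ℂ) (hf : IsMultFn f)
    (hfb : ∀ g, ‖f g‖ ≤ 1) :
    Tendsto (fun n : ℕ => (1 / (Fintype.card (GaloisField p r) : ℂ) ^ n) *
        ∑ c : Fin n → GaloisField p r, f (polyOf c) * stdChar p r (linForm θ (polyOf c)))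
      atTop (nhds 0) := by
  simp_rw [← sum_polyBox _ fun g => f g * stdChar p r (linForm θ g)]
  refine tendsto_mean_mul_character hf hfb (fun g => (norm_stdChar _).le) (fun a b => ?_)
    fun b hb => eventually_sum_stdChar_linForm_eq_zero θ b (hirr b hb)
  have h : stdChar p r (linForm θ a) =
      stdChar p r (linForm θ (a - b)) * stdChar p r (linForm θ b) := by
    rw [← stdChar_add, ← linForm_add, sub_add_cancel]
  rw [h, mul_assoc, Complex.mul_conj, Complex.normSq_eq_norm_sq, norm_stdChar]
  simp
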